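/- Let T be a Laver tree and let A ⊆ [T] be an analytic set. Then there exists a direct extension S ≤₀ T such that either [S] ⊆ A or [S] ∩ A = ∅. -/

import Mathlib

open Set Filter

/-- The restriction of `x : ℕ → ℕ` to `{0,…,n-1}`, as a finite sequence. -/
def seg (x : ℕ → ℕ) (n : ℕ) : List ℕ := List.ofFn fun i : Fin n => x i

/-- `s` is the stem of the tree `T`: it belongs to `T`, is comparable with every
element of `T`, and every node of `T` extending it splits infinitely. -/
def IsStemOf (T : Set (List ℕ)) (s : List ℕ) : Prop :=
  s ∈ T ∧ (∀ t ∈ T, t <+: s ∨ s <+: t) ∧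
    ∀ t ∈ T, s <+: t → {n : ℕ | t ++ [n] ∈ T}.Infinite

/-- A Laver tree: closed under initial segments, with a stem. -/
def IsLaverTree (T : Set (List ℕ)) : Prop :=
  (∀ s ∈ T, ∀ t : List ℕ, t <+: s → t ∈ T) ∧ ∃ s, IsStemOf T s

/-- `[T]`, the set of branches of `T`. -/
def branches (T : Set (List ℕ)) : Set (ℕ → ℕ) := {x | ∀ n, seg x n ∈ T}

/-- `S ≤₀ T`: `S` is a Laver tree included in `T` with the same stem. -/
def DirectExt (S T : Set (List ℕ)) : Prop :=
  IsLaverTree S ∧ S ⊆ T ∧ ∃ s, IsStemOf S s ∧ IsStemOf T s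

/-- An (proper, containing all finite sets) ideal on ℕ. -/
def IsIdeal (I : Set (Set ℕ)) : Prop :=
  (∀ A : Set ℕ, A.Finite → A ∈ I) ∧ (∀ A B : Set ℕ, A ⊆ B → B ∈ I → A ∈ I) ∧
    (∀ A B : Set ℕ, A ∈ I → B ∈ I → A ∪ B ∈ I) ∧ (Set.univ : Set ℕ) ∉ I

/-- A P-ideal. -/
def IsPIdeal (I : Set (Set ℕ)) : Prop :=
  ∀ A : ℕ → Set ℕ, (∀ n, A n ∈ I) → ∃ B ∈ I, ∀ n, (A n \ B).Finite

/-- Characteristic function of a subset of ℕ, as a point of the Cantor space. -/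
noncomputable def chi (A : Set ℕ) : ℕ → Bool :=
  fun n => @decide (n ∈ A) (Classical.propDecidable _)

/-- An F_σ set: a countable union of closed sets. -/
def IsFsigma {X : Type*} [TopologicalSpace X] (A : Set X) : Prop :=
  ∃ F : ℕ → Set X, (∀ n, IsClosed (F n)) ∧ A = ⋃ n, F n

/-- An ideal on ℕ is F_σ if its copy in the Cantor space `ℕ → Bool` is F_σ. -/
def FsigmaIdeal (I : Set (Set ℕ)) : Prop := IsFsigma (chi '' I)

/-- The equivalence relation `E_I` on the Cantor space induced by an ideal `I`. -/
def EI (I : Set (Set ℕ)) (x y : ℕ → Bool) : Prop := {n | x n ≠ y n} ∈ I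

/-- The generator `A_g` of the Laver ideal. -/
def laverGen (g : List ℕ → ℕ) : Set (ℕ → ℕ) := {f | {n | f n < g (seg f n)}.Infinite}

/-- Membership in the Laver ideal: covered by countably many generators. -/
def InLaverIdeal (A : Set (ℕ → ℕ)) : Prop :=
  ∃ g : ℕ → List ℕ → ℕ, A ⊆ ⋃ i, laverGen (g i)

/-- The relation `K` on the Baire space. -/
def Krel (x y : ℕ → ℕ) : Prop :=
  ∃ b : ℕ, ∀ n : ℕ, ∃ mx ≤ b, ∃ my ≤ b, x n ≤ y (n + my) ∧ y n ≤ x (n + mx)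

/-- `E_{ℓ∞}` on `ℝ^ℕ`: the difference sequence is bounded. -/
def Elinf (x y : ℕ → ℝ) : Prop := ∃ C : ℝ, ∀ n, |x n - y n| ≤ C

/-- A lower semicontinuous submeasure on ℕ. -/
def IsLSCSubmeasure (μ : Set ℕ → ENNReal) : Prop :=
  μ ∅ = 0 ∧ (∀ A B : Set ℕ, A ⊆ B → μ A ≤ μ B) ∧
    (∀ A B : Set ℕ, μ (A ∪ B) ≤ μ A + μ B) ∧
    ∀ A : Set ℕ, μ A = ⨆ n : ℕ, μ (A ∩ Set.Iio n)

/-- `Exh(μ)`. -/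
def Exh (μ : Set ℕ → ENNReal) : Set (Set ℕ) :=
  {A | Filter.Tendsto (fun n : ℕ => μ (A \ Set.Iio n)) Filter.atTop (nhds 0)}

/-- `Fin(μ)`. -/
def FinSub (μ : Set ℕ → ENNReal) : Set (Set ℕ) := {A | μ A < ⊤}

theorem length_seg (x : ℕ → ℕ) (n : ℕ) : (seg x n).length = n := by simp [seg]

theorem seg_succ (x : ℕ → ℕ) (n : ℕ) : seg x (n + 1) = seg x n ++ [x n] := by
  rw [seg, List.ofFn_succ_last]
  rfl

theorem seg_eq_seg_iff {x y : ℕ → ℕ} {n : ℕ} : seg x n = seg y n ↔ ∀ i < n, x i = y i := by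
  simp [seg, List.ofFn_inj, funext_iff, Fin.forall_iff]

theorem take_seg (x : ℕ → ℕ) {i n : ℕ} (h : i ≤ n) : (seg x n).take i = seg x i := by
  apply List.ext_getElem
  · simp [seg, h]
  · intro j h₁ h₂
    simp [seg]

theorem seg_prefix_seg (x : ℕ → ℕ) {i n : ℕ} (h : i ≤ n) : seg x i <+: seg x n := by
  rw [← take_seg x h]
  exact List.take_prefix _ _

theorem seg_length_eq_of_comparable {x : ℕ → ℕ} {s : List ℕ}
    (h : seg x s.length <+: s ∨ s <+: seg x s.length) : seg x s.length = s := by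
  rcases h with h | h
  · exact h.eq_of_length (length_seg _ _)
  · exact (h.eq_of_length (length_seg _ _).symm).symm

/-- Every function `g` is eventually dominated, in the sense of the Laver game starting at `s`,
by some element of `X` passing through `s`. -/
def LaverPositive (s : List ℕ) (X : Set (ℕ → ℕ)) : Prop :=
  ∀ g : List ℕ → ℕ, ∃ x ∈ X, seg x s.length = s ∧ ∀ i ≥ s.length, g (seg x i) ≤ x i

theorem LaverPositive.infinite_succ {s : List ℕ} {X : Set (ℕ → ℕ)} (h : LaverPositive s X) :
    {m | LaverPositive (s ++ [m]) X}.Infinite := by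
  intro hfin
  obtain ⟨N, hN⟩ := hfin.bddAbove
  have key : ∀ m, ∃ g : List ℕ → ℕ, N < m →
      ∀ x ∈ X, seg x (s ++ [m]).length = s ++ [m] →
        ∃ i ≥ (s ++ [m]).length, x i < g (seg x i) := by
    intro m
    by_cases hm : LaverPositive (s ++ [m]) X
    · exact ⟨0, fun hlt => absurd (hN hm) (by simpa using hlt)⟩
    · unfold LaverPositive at hm
      push Not at hm
      obtain ⟨g, hg⟩ := hm
      exact ⟨g, fun _ => hg⟩
  choose g hg using key
  obtain ⟨x, hxX, hxs, hx⟩ :=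
    h fun t => if t.length ≤ s.length then N + 1 else g (t.getD s.length 0) t
  have hlt : N < x s.length := by
    have := hx s.length le_rfl
    simp only [length_seg, le_refl, if_true] at this
    omega
  obtain ⟨i, hi, hlt'⟩ := hg _ hlt x hxX (by simp [seg_succ, hxs])
  simp only [List.length_append, List.length_singleton, ge_iff_le] at hi
  have := hx i (by omega)
  rw [length_seg, if_neg (by omega)] at this
  have hget : (seg x i).getD s.length 0 = x s.length := by
    rw [List.getD_eq_getElem _ _ (by rw [length_seg]; omega)]
    simp [seg]
  rw [hget] at this
  omega

/-- A well-founded tree of infinite branchings, starting at a node, all of whose terminal nodes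
satisfy `G`. -/
inductive ReachTree (G : List ℕ → Prop) : List ℕ → Type
  | base (t : List ℕ) (h : G t) : ReachTree G t
  | step (t : List ℕ) (M : Set ℕ) (hM : M.Infinite)
      (w : ∀ m, m ∈ M → ReachTree G (t ++ [m])) : ReachTree G t

theorem LaverPositive.nonempty_reachTree {s : List ℕ} {X : Set (ℕ → ℕ)} {Y : ℕ → Set (ℕ → ℕ)}
    (hXY : X ⊆ ⋃ k, Y k) (h : LaverPositive s X) :
    Nonempty (ReachTree (fun t => ∃ k, LaverPositive t (Y k)) s) := by
  classical
  by_contra hs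
  set G : List ℕ → Prop := fun t => ∃ k, LaverPositive t (Y k) with hG
  have hbound : ∀ t, ∃ N, ¬ Nonempty (ReachTree G t) →
      ∀ m ≥ N, ¬ Nonempty (ReachTree G (t ++ [m])) := by
    intro t
    by_cases ht : Nonempty (ReachTree G t)
    · exact ⟨0, fun h' => absurd ht h'⟩
    · have hfin : {m | Nonempty (ReachTree G (t ++ [m]))}.Finite := by
        by_contra hinf
        exact ht ⟨.step t _ hinf fun m hm => Classical.choice hm⟩
      obtain ⟨N, hN⟩ := hfin.bddAbove
      refine ⟨N + 1, fun _ m hm hne => ?_⟩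
      have : m ≤ N := hN hne
      omega
  choose b hb using hbound
  have hwit : ∀ t k, ∃ g : List ℕ → ℕ, ¬ LaverPositive t (Y k) →
      ∀ x ∈ Y k, seg x t.length = t → ∃ i ≥ t.length, x i < g (seg x i) := by
    intro t k
    by_cases hm : LaverPositive t (Y k)
    · exact ⟨0, fun h' => absurd hm h'⟩
    · have hm' := hm
      unfold LaverPositive at hm'
      push Not at hm'
      obtain ⟨g, hg⟩ := hm'
      exact ⟨g, fun _ => hg⟩
  choose g hg using hwit
  obtain ⟨x, hxX, hxs, hx⟩ := h fun t =>
    max (b t) ((Finset.range (t.length + 1)).sup fun i =>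
      (Finset.range (t.length + 1)).sup fun k => g (t.take i) k t)
  have hempty : ∀ n ≥ s.length, ¬ Nonempty (ReachTree G (seg x n)) := by
    intro n hn
    induction n, hn using Nat.le_induction with
    | base => rwa [hxs]
    | succ n hn ih =>
      rw [seg_succ]
      exact hb _ ih _ ((le_max_left _ _).trans (hx n hn))
  obtain ⟨k, hk⟩ := mem_iUnion.1 (hXY hxX)
  set i := max k s.length with hi
  have hnot : ¬ LaverPositive (seg x i) (Y k) := fun hp =>
    hempty i (le_max_right _ _) ⟨.base _ ⟨k, hp⟩⟩
  obtain ⟨j, hj, hlt⟩ := hg _ _ hnot x hk (by rw [length_seg])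
  rw [length_seg] at hj
  have hle := (le_max_right _ _).trans (hx j (by omega))
  rw [length_seg] at hle
  have h₁ : g (seg x i) k (seg x j) ≤
      (Finset.range (j + 1)).sup fun k => g ((seg x j).take i) k (seg x j) := by
    rw [take_seg x hj]
    exact Finset.le_sup (f := fun k => g (seg x i) k (seg x j)) (by simp; omega)
  have h₂ := Finset.le_sup (s := Finset.range (j + 1))
    (f := fun i => (Finset.range (j + 1)).sup fun k => g ((seg x j).take i) k (seg x j))
    (b := i) (by simp; omega)
  have := h₁.trans (h₂.trans hle)
  omega

/-- The image under `f` of the basic clopen set determined by `u`. -/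
def cylinderImage (f : (ℕ → ℕ) → ℕ → ℕ) (u : List ℕ) : Set (ℕ → ℕ) :=
  f '' {z | seg z u.length = u}

theorem cylinderImage_subset_iUnion (f : (ℕ → ℕ) → ℕ → ℕ) (u : List ℕ) :
    cylinderImage f u ⊆ ⋃ k, cylinderImage f (u ++ [k]) := by
  rintro _ ⟨z, hz, rfl⟩
  refine mem_iUnion.2 ⟨z u.length, z, ?_, rfl⟩
  have hz' : seg z u.length = u := hz
  simp [seg_succ, hz']

/-- Some one-step extension of the label `u` has Laver positive cylinder image at `t`. -/
def LabelExtends (f : (ℕ → ℕ) → ℕ → ℕ) (u t : List ℕ) : Prop :=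
  ∃ k, LaverPositive t (cylinderImage f (u ++ [k]))

/-- A node of the Laver tree under construction, with its label, its set of successors and a
strategy for reaching a longer label. -/
structure FusionNode (f : (ℕ → ℕ) → ℕ → ℕ) where
  node : List ℕ
  label : List ℕ
  succs : Set ℕ
  infinite_succs : succs.Infinite
  reach : ∀ m, m ∈ succs → ReachTree (LabelExtends f label) (node ++ [m])

namespace FusionNode

variable {f : (ℕ → ℕ) → ℕ → ℕ}

/-- The fusion node attached to a Laver positive cylinder image. -/
noncomputable def ofPositive (u t : List ℕ) (h : LaverPositive t (cylinderImage f u)) :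
    FusionNode f where
  node := t
  label := u
  succs := {m | LaverPositive (t ++ [m]) (cylinderImage f u)}
  infinite_succs := h.infinite_succ
  reach _ hm := Classical.choice
    (LaverPositive.nonempty_reachTree (cylinderImage_subset_iUnion f u) hm)

/-- The fusion node attached to a reaching tree, extending the label if the tree is trivial. -/
noncomputable def ofReachTree (u t : List ℕ) : ReachTree (LabelExtends f u) t → FusionNode f
  | .base _ h => ofPositive (u ++ [h.choose]) t h.choose_spec
  | .step _ M hM w => ⟨t, u, M, hM, w⟩

@[simp]
theorem node_ofReachTree (u t : List ℕ) (w : ReachTree (LabelExtends f u) t) :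
    (ofReachTree u t w).node = t := by
  cases w <;> rfl

/-- The immediate successor of a fusion node in the direction `m`. -/
noncomputable def next (N : FusionNode f) (m : ℕ) (hm : m ∈ N.succs) : FusionNode f :=
  ofReachTree N.label (N.node ++ [m]) (N.reach m hm)

/-- The finite sequence `l` can be followed from the fusion node `N`. -/
def Follows : List ℕ → FusionNode f → Prop
  | [], _ => True
  | m :: l, N => ∃ hm : m ∈ N.succs, Follows l (N.next m hm)

theorem Follows.of_append {l l' : List ℕ} {N : FusionNode f} (h : Follows (l ++ l') N) :
    Follows l N := by
  induction l generalizing N with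
  | nil => trivial
  | cons m l ih => exact ⟨h.1, ih h.2⟩

theorem Follows.infinite {l : List ℕ} {N : FusionNode f} (h : Follows l N) :
    {m | Follows (l ++ [m]) N}.Infinite := by
  induction l generalizing N with
  | nil => exact N.infinite_succs.mono fun m hm => ⟨hm, trivial⟩
  | cons k l ih => exact (ih h.2).mono fun m hm => ⟨h.1, hm⟩

theorem Follows.exists_node {l : List ℕ} {N : FusionNode f} (h : Follows l N) :
    ∃ N' : FusionNode f, N'.node = N.node ++ l := by
  induction l generalizing N with
  | nil => exact ⟨N, by simp⟩
  | cons m l ih =>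
    obtain ⟨N', hN'⟩ := ih h.2
    exact ⟨N', by simp [hN', next]⟩

theorem exists_mem_of_reachTree {u t : List ℕ} (w : ReachTree (LabelExtends f u) t) :
    ∃ x ∈ cylinderImage f u, seg x t.length = t := by
  induction w with
  | base t h =>
    obtain ⟨k, hk⟩ := h
    obtain ⟨x, ⟨z, hz, rfl⟩, hx, -⟩ := hk 0
    have hz' : seg z (u ++ [k]).length = u ++ [k] := hz
    rw [List.length_append, List.length_singleton, seg_succ] at hz'
    exact ⟨_, ⟨z, (List.append_inj' hz' rfl).1, rfl⟩, hx⟩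
  | step t M hM w ih =>
    obtain ⟨m, hm⟩ := hM.nonempty
    obtain ⟨x, hx, hxt⟩ := ih m hm
    rw [List.length_append, List.length_singleton, seg_succ] at hxt
    exact ⟨x, hx, (List.append_inj' hxt rfl).1⟩

theorem exists_mem (N : FusionNode f) :
    ∃ x ∈ cylinderImage f N.label, seg x N.node.length = N.node := by
  obtain ⟨node, label, succs, hs, w⟩ := N
  exact exists_mem_of_reachTree (.step node succs hs w)

/-- `x` is a branch through `N` of the tree of sequences that can be followed from `N`. -/
def IsBranch (N : FusionNode f) (x : ℕ → ℕ) : Prop :=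
  seg x N.node.length = N.node ∧ ∀ n l, seg x n = N.node ++ l → Follows l N

theorem IsBranch.next {N : FusionNode f} {x : ℕ → ℕ} (h : N.IsBranch x) :
    ∃ hm : x N.node.length ∈ N.succs, (N.next _ hm).IsBranch x := by
  have hseg : seg x (N.node.length + 1) = N.node ++ [x N.node.length] := by
    rw [seg_succ, h.1]
  have hm : x N.node.length ∈ N.succs := (h.2 _ _ hseg).1
  refine ⟨hm, ?_, fun n l hl => ?_⟩
  · simpa [FusionNode.next] using hseg
  · exact (h.2 n (x N.node.length :: l) (by simpa [FusionNode.next] using hl)).2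

theorem exists_label_ofReachTree {u t : List ℕ} (w : ReachTree (LabelExtends f u) t)
    {x : ℕ → ℕ} (h : (ofReachTree u t w).IsBranch x) :
    ∃ (N : FusionNode f) (k : ℕ), N.label = u ++ [k] ∧ t.length ≤ N.node.length ∧
      N.IsBranch x := by
  induction w with
  | base t hG => exact ⟨_, hG.choose, rfl, le_rfl, h⟩
  | step t M hM w ih =>
    obtain ⟨hm, hb⟩ := h.next
    obtain ⟨N, k, hN, hle, hbr⟩ := ih _ hm hb
    refine ⟨N, k, hN, ?_, hbr⟩
    rw [List.length_append] at hle
    omega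

theorem IsBranch.exists_label {N : FusionNode f} {x : ℕ → ℕ} (h : N.IsBranch x) :
    ∃ (N' : FusionNode f) (k : ℕ), N'.label = N.label ++ [k] ∧
      N.node.length < N'.node.length ∧ N'.IsBranch x := by
  obtain ⟨hm, hb⟩ := h.next
  obtain ⟨N', k, hN', hle, hbr⟩ := exists_label_ofReachTree _ hb
  refine ⟨N', k, hN', ?_, hbr⟩
  rw [List.length_append, List.length_singleton] at hle
  omega

theorem IsBranch.mem_range (hf : Continuous f) {N : FusionNode f} {x : ℕ → ℕ}
    (h : N.IsBranch x) (hN : N.label = []) : x ∈ range f := by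
  choose F k hlabel hlen hbr using
    fun N : {N : FusionNode f // N.IsBranch x} => N.2.exists_label
  let P : ℕ → {N : FusionNode f // N.IsBranch x} :=
    fun n => Nat.rec ⟨N, h⟩ (fun _ Q => ⟨F Q, hbr Q⟩) n
  have hP : ∀ n, (P (n + 1)).1 = F (P n) := fun n => rfl
  let z : ℕ → ℕ := fun n => k (P n)
  have hz : ∀ n, (P n).1.label = seg z n := by
    intro n
    induction n with
    | zero => exact hN.trans (by simp [seg])
    | succ n ih => rw [hP, hlabel, ih, seg_succ]
  have hn : ∀ n, n ≤ (P n).1.node.length := by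
    intro n
    induction n with
    | zero => exact Nat.zero_le _
    | succ n ih => rw [hP]; exact lt_of_le_of_lt ih (hlen (P n))
  have hex : ∀ n, ∃ y, seg y n = seg z n ∧ seg (f y) n = seg x n := by
    intro n
    obtain ⟨_, ⟨y, hy, rfl⟩, hxy⟩ := (P n).1.exists_mem
    have hy' : seg y (P n).1.label.length = (P n).1.label := hy
    rw [hz, length_seg] at hy'
    rw [← (P n).2.1, length_seg, seg_eq_seg_iff] at hxy
    exact ⟨y, hy', seg_eq_seg_iff.2 fun i hi => hxy i (hi.trans_le (hn n))⟩
  choose y hyz hyx using hex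
  have tendsto_of_seg : ∀ (v : ℕ → ℕ → ℕ) (a : ℕ → ℕ), (∀ n, seg (v n) n = seg a n) →
      Tendsto v atTop (nhds a) := by
    intro v a hv
    refine tendsto_pi_nhds.2 fun i => tendsto_const_nhds.congr' ?_
    filter_upwards [eventually_gt_atTop i] with n hin
    exact (seg_eq_seg_iff.1 (hv n) i hin).symm
  exact ⟨z, tendsto_nhds_unique ((hf.tendsto z).comp (tendsto_of_seg y z hyz))
    (tendsto_of_seg (fun n => f (y n)) x hyx)⟩

/-- The Laver tree generated by a fusion node. -/
def tree (N : FusionNode f) : Set (List ℕ) :=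
  {t | t <+: N.node ∨ ∃ l, Follows l N ∧ t = N.node ++ l}

theorem tree_prefix_closed (N : FusionNode f) :
    ∀ s ∈ N.tree, ∀ t : List ℕ, t <+: s → t ∈ N.tree := by
  rintro s (hs | ⟨l, hl, rfl⟩) t ht
  · exact .inl (ht.trans hs)
  · rcases List.prefix_or_prefix_of_prefix ht (List.prefix_append N.node l) with h | ⟨l', rfl⟩
    · exact .inl h
    · obtain ⟨r, rfl⟩ := (List.prefix_append_right_inj _).1 ht
      exact .inr ⟨l', hl.of_append, rfl⟩

theorem exists_follows_of_mem_tree {N : FusionNode f} {t : List ℕ} (ht : t ∈ N.tree)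
    (hN : N.node <+: t) : ∃ l, Follows l N ∧ t = N.node ++ l := by
  rcases ht with h | h
  · exact ⟨[], trivial, by simpa using h.eq_of_length_le hN.length_le⟩
  · exact h

theorem isStemOf_tree (N : FusionNode f) : IsStemOf N.tree N.node := by
  refine ⟨.inl List.prefix_rfl, ?_, fun t ht hN => ?_⟩
  · rintro t (h | ⟨l, -, rfl⟩)
    · exact .inl h
    · exact .inr (List.prefix_append _ _)
  · obtain ⟨l, hl, rfl⟩ := exists_follows_of_mem_tree ht hN
    exact hl.infinite.mono fun m hm => .inr ⟨l ++ [m], hm, by simp⟩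

theorem isBranch_of_mem_branches {N : FusionNode f} {x : ℕ → ℕ} (hx : x ∈ branches N.tree) :
    N.IsBranch x := by
  refine ⟨seg_length_eq_of_comparable (N.isStemOf_tree.2.1 _ (hx _)), fun n l hl => ?_⟩
  obtain ⟨l', hl', heq⟩ :=
    exists_follows_of_mem_tree (hx n) (hl ▸ List.prefix_append N.node l)
  rw [hl] at heq
  rwa [List.append_cancel_left heq]

theorem exists_mem_range_of_mem_tree {N : FusionNode f} {t : List ℕ} (ht : t ∈ N.tree) :
    ∃ x ∈ range f, seg x t.length = t := by
  have aux : ∀ (N' : FusionNode f), t <+: N'.node → ∃ x ∈ range f, seg x t.length = t := by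
    intro N' hN'
    obtain ⟨_, ⟨z, -, rfl⟩, hx⟩ := N'.exists_mem
    refine ⟨_, mem_range_self z, ?_⟩
    rw [← take_seg _ hN'.length_le, hx]
    exact (List.prefix_iff_eq_take.1 hN').symm
  rcases ht with h | ⟨l, hl, rfl⟩
  · exact aux N h
  · obtain ⟨N', hN'⟩ := hl.exists_node
    exact aux N' (hN' ▸ List.prefix_rfl)

end FusionNode

/-- If `A` is not Laver positive at the stem of `T`, some direct extension of `T` avoids `A`. -/
theorem exists_directExt_disjoint {T : Set (List ℕ)} (hT : IsLaverTree T) {s : List ℕ}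
    (hs : IsStemOf T s) {A : Set (ℕ → ℕ)} (hA : ¬ LaverPositive s A) :
    ∃ S, DirectExt S T ∧ branches S ∩ A = ∅ := by
  unfold LaverPositive at hA
  push Not at hA
  obtain ⟨g, hg⟩ := hA
  let S : Set (List ℕ) := {t | t ∈ T ∧ ∀ p m, s <+: p → p ++ [m] <+: t → g p ≤ m}
  have hstem : IsStemOf S s := by
    refine ⟨⟨hs.1, fun p m hp hm => ?_⟩, fun t ht => hs.2.1 t ht.1, fun t ht hst => ?_⟩
    · have h₁ := hp.length_le
      have h₂ := hm.length_le
      simp only [List.length_append, List.length_singleton] at h₂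
      omega
    · refine ((hs.2.2 t ht.1 hst).sdiff (finite_Iio (g t))).mono fun n hn => ⟨hn.1, ?_⟩
      intro p m hp hm
      rcases List.prefix_concat_iff.1 hm with h | h
      · obtain ⟨rfl, h'⟩ := List.append_inj' h rfl
        obtain rfl : m = n := by simpa using h'
        simpa using hn.2
      · exact ht.2 p m hp h
  refine ⟨S, ⟨⟨fun t ht t' ht' => ⟨hT.1 t ht.1 t' ht', fun p m hp hm =>
    ht.2 p m hp (hm.trans ht')⟩, s, hstem⟩, fun t ht => ht.1, s, hstem, hs⟩, ?_⟩
  refine eq_empty_of_forall_notMem fun x hx => ?_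
  have hxs := seg_length_eq_of_comparable (hs.2.1 _ (hx.1 s.length).1)
  obtain ⟨i, hi, hlt⟩ := hg x hx.2 hxs
  have hp : s <+: seg x i := by
    have := seg_prefix_seg x hi
    rwa [hxs] at this
  have := (hx.1 (i + 1)).2 (seg x i) (x i) hp (by rw [seg_succ])
  omega


/-- for an analytic `A ⊆ [T]` there is a direct extension `S ≤₀ T`
with `[S] ⊆ A` or `[S] ∩ A = ∅`. -/
theorem stmt3 (T : Set (List ℕ)) (hT : IsLaverTree T) (A : Set (ℕ → ℕ))
    (hAsub : A ⊆ branches T) (hA : MeasureTheory.AnalyticSet A) :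
    ∃ S, DirectExt S T ∧ (branches S ⊆ A ∨ branches S ∩ A = ∅) := by
  classical
  obtain ⟨s, hs⟩ := hT.2
  by_cases hpos : LaverPositive s A
  · rw [MeasureTheory.AnalyticSet] at hA
    rcases hA with rfl | ⟨f, hf, rfl⟩
    · obtain ⟨x, hx, -⟩ := hpos 0
      exact hx.elim
    · have himage : cylinderImage f [] = range f := by simp [cylinderImage, seg]
      let N : FusionNode f := .ofPositive [] s (himage ▸ hpos)
      have hstem : IsStemOf N.tree s := N.isStemOf_tree
      refine ⟨N.tree, ⟨⟨N.tree_prefix_closed, s, hstem⟩, fun t ht => ?_, s, hstem, hs⟩,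
        .inl fun x hx => (FusionNode.isBranch_of_mem_branches hx).mem_range hf rfl⟩
      obtain ⟨x, hx, hxt⟩ := FusionNode.exists_mem_range_of_mem_tree ht
      exact hxt ▸ hAsub hx t.length
  · obtain ⟨S, hS, hdisj⟩ := exists_directExt_disjoint hT hs hpos
    exact ⟨S, hS, .inr hdisj⟩
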